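/- arXiv:1201.2142 — 9 statements merged into one kernel-verified Lean document; each statement's English description precedes it below -/
import Mathlib

section
/- Let β be a real skew-symmetric n×n matrix (βᵀ = −β) and let τ ∈ ℝ. Then the matrix S = Σ_{k≥0} (−1)^k (τβ)^{2k}/(2k+1)! is invertible. -/
open scoped Nat

/-- The power series `Σ_{k≥0} x^k / (2k+1)!` converges for every real `x`. -/
theorem summable_pow_div_factorial_two_mul_add_one (x : ℝ) :
    Summable fun k : ℕ => x ^ k / ((2 * k + 1)! : ℝ) := by
  refine Summable.of_norm_bounded (Real.summable_pow_div_factorial |x|) fun k => ?_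
  rw [norm_div, norm_pow, Real.norm_eq_abs, RCLike.norm_natCast]
  gcongr
  omega

/-- For `x ≥ 0` the power series `Σ_{k≥0} x^k / (2k+1)!` has positive sum. -/
theorem tsum_pow_div_factorial_two_mul_add_one_pos {x : ℝ} (hx : 0 ≤ x) :
    0 < ∑' k : ℕ, x ^ k / ((2 * k + 1)! : ℝ) :=
  (summable_pow_div_factorial_two_mul_add_one x).tsum_pos (fun k => by positivity) 0 (by simp)

/-- The diagonal matrices with entries `e i ^ k / (2k+1)!` sum entrywise. -/
theorem hasSum_diagonal_pow_div_factorial {ι : Type*} [DecidableEq ι] (e : ι → ℝ) :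
    HasSum (fun k : ℕ => Matrix.diagonal fun i => e i ^ k / ((2 * k + 1)! : ℝ))
      (Matrix.diagonal fun i => ∑' k : ℕ, e i ^ k / ((2 * k + 1)! : ℝ)) := by
  have hentries : HasSum (fun (k : ℕ) i => e i ^ k / ((2 * k + 1)! : ℝ))
      (fun i => ∑' k : ℕ, e i ^ k / ((2 * k + 1)! : ℝ)) :=
    Pi.hasSum.2 fun i => (summable_pow_div_factorial_two_mul_add_one (e i)).hasSum
  exact hentries.matrix_diagonal

/-- For a positive semidefinite real matrix `M`, the sum of `M^k / (2k+1)!` is invertible. -/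
theorem Matrix.PosSemidef.isUnit_tsum_pow_div_factorial {ι : Type*} [Fintype ι] [DecidableEq ι]
    {M : Matrix ι ι ℝ} (hM : M.PosSemidef) :
    IsUnit (∑' k : ℕ, ((2 * k + 1)! : ℝ)⁻¹ • M ^ k) := by
  set U := hM.isHermitian.eigenvectorUnitary
  set e := hM.isHermitian.eigenvalues
  have hpow (k : ℕ) : ((2 * k + 1)! : ℝ)⁻¹ • M ^ k =
      (U : Matrix ι ι ℝ) * Matrix.diagonal (fun i => e i ^ k / ((2 * k + 1)! : ℝ)) *
        (star U : Matrix ι ι ℝ) := by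
    have hdiag : Matrix.diagonal (fun i => e i ^ k / ((2 * k + 1)! : ℝ)) =
        ((2 * k + 1)! : ℝ)⁻¹ • Matrix.diagonal e ^ k := by
      rw [Matrix.diagonal_pow, ← Matrix.diagonal_smul]
      congr 1
      ext i
      simp [div_eq_inv_mul]
    conv_lhs => rw [hM.isHermitian.spectral_theorem, ← map_pow, ← map_smul]
    rw [hdiag, Unitary.conjStarAlgAut_apply]
    rfl
  have hsum : HasSum (fun k : ℕ => ((2 * k + 1)! : ℝ)⁻¹ • M ^ k)
      ((U : Matrix ι ι ℝ) *
        Matrix.diagonal (fun i => ∑' k : ℕ, e i ^ k / ((2 * k + 1)! : ℝ)) *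
        (star U : Matrix ι ι ℝ)) := by
    simp_rw [hpow]
    exact ((hasSum_diagonal_pow_div_factorial e).mul_left _).mul_right _
  rw [hsum.tsum_eq]
  refine (IsUnit.mul (Unitary.toUnits U).isUnit ?_).mul (Unitary.toUnits (star U)).isUnit
  rw [Matrix.isUnit_diagonal, Pi.isUnit_iff]
  exact fun i =>
    (tsum_pow_div_factorial_two_mul_add_one_pos (hM.eigenvalues_nonneg i)).ne'.isUnit

/-- For a real skew-symmetric matrix `β` and `τ ∈ ℝ`, the matrix
`S = Σ_{k≥0} (−1)^k (τβ)^{2k}/(2k+1)!` (i.e. `sin(τβ)/(τβ)`) is invertible. -/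
theorem stmt_1 (n : ℕ) (β : Matrix (Fin n) (Fin n) ℝ) (hβ : β.transpose = -β) (τ : ℝ) :
    IsUnit (∑' k : ℕ, ((-1 : ℝ) ^ k / ((2 * k + 1)! : ℝ)) • (τ • β) ^ (2 * k)) := by
  have hsq : (τ • β).conjTranspose * (τ • β) = (-1 : ℝ) • (τ • β) ^ 2 := by
    simp [Matrix.conjTranspose_eq_transpose_of_trivial, hβ, sq]
  have hunit := (Matrix.posSemidef_conjTranspose_mul_self (τ • β)).isUnit_tsum_pow_div_factorial
  simp_rw [hsq, smul_pow (-1 : ℝ), ← pow_mul, smul_smul, ← div_eq_inv_mul] at hunit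
  exact hunit
end

section
/- Let β be a real skew-symmetric n×n matrix (βᵀ = −β) and let τ > 0. Then the complex matrix M = Σ_{k≥0} (−2iτβ)^k/(k+1)! is Hermitian, and for every nonzero vector v ∈ ℂⁿ the number v* M v is real and strictly positive. -/
open scoped Nat
open Matrix
open scoped ComplexOrder

/-- The power series of `(exp x - 1) / x` converges to a positive sum at every real `x`. -/
lemma exists_pos_hasSum_inv_factorial_succ_mul_pow (x : ℝ) :
    ∃ s : ℝ, 0 < s ∧ HasSum (fun k : ℕ => ((k + 1)! : ℝ)⁻¹ * x ^ k) s := by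
  rcases eq_or_ne x 0 with rfl | hx
  · refine ⟨1, one_pos, ?_⟩
    convert hasSum_single (f := fun k : ℕ => ((k + 1)! : ℝ)⁻¹ * (0 : ℝ) ^ k) 0 ?_ using 1
    · simp
    · intro k hk
      simp [hk]
  · refine ⟨(Real.exp x - 1) / x, ?_, ?_⟩
    · rcases hx.lt_or_gt with h | h
      · exact div_pos_of_neg_of_neg (sub_neg.2 (Real.exp_lt_one_iff.2 h)) h
      · exact div_pos (sub_pos.2 (Real.one_lt_exp_iff.2 h)) h
    · have hexp : HasSum (fun k : ℕ => x ^ k / (k ! : ℝ)) (Real.exp x) := by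
        rw [Real.exp_eq_exp_ℝ]
        exact NormedSpace.expSeries_div_hasSum_exp x
      have hshift := ((hasSum_nat_add_iff' 1).2 hexp).div_const x
      simp only [Finset.sum_range_one, pow_zero, Nat.factorial_zero, Nat.cast_one,
        div_one] at hshift
      refine hshift.congr_fun fun k => ?_
      field_simp
      rw [pow_succ]

/-- A power series with real coefficients whose sums at real points are all positive sends
Hermitian matrices to positive definite ones. -/
lemma Matrix.IsHermitian.posDef_tsum_smul_pow {m : Type*} [Fintype m] [DecidableEq m]
    {A : Matrix m m ℂ} (hA : A.IsHermitian) {c : ℕ → ℝ}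
    (hc : ∀ x : ℝ, ∃ s : ℝ, 0 < s ∧ HasSum (fun k => c k * x ^ k) s) :
    (∑' k, (c k : ℂ) • A ^ k).PosDef := by
  choose s hs_pos hs using hc
  set U : Matrix m m ℂ := ↑hA.eigenvectorUnitary
  have hU : IsUnit U := (Unitary.toUnits hA.eigenvectorUnitary).isUnit
  have hpow (k : ℕ) : A ^ k = U * diagonal (fun i => (hA.eigenvalues i : ℂ) ^ k) * star U := by
    conv_lhs => rw [hA.spectral_theorem, ← map_pow, diagonal_pow, Unitary.conjStarAlgAut_apply]
    rfl
  have hdiag : HasSum (fun k => diagonal fun i => (c k : ℂ) * (hA.eigenvalues i : ℂ) ^ k)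
      (diagonal fun i => (s (hA.eigenvalues i) : ℂ)) := by
    refine HasSum.matrix_diagonal (Pi.hasSum.2 fun i => ?_)
    exact_mod_cast Complex.hasSum_ofReal.2 (hs (hA.eigenvalues i))
  have hsum : HasSum (fun k => (c k : ℂ) • A ^ k)
      (U * diagonal (fun i => (s (hA.eigenvalues i) : ℂ)) * star U) := by
    refine ((hdiag.mul_left U).mul_right (star U)).congr_fun fun k => ?_
    rw [hpow, ← Matrix.smul_mul, ← Matrix.mul_smul, ← diagonal_smul]
    rfl
  rw [hsum.tsum_eq, Matrix.IsUnit.posDef_star_right_conjugate_iff hU, posDef_diagonal_iff]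
  exact fun i => by exact_mod_cast hs_pos _

/-- For a real skew-symmetric matrix `β` and `τ > 0`, the matrix
`M = Σ_{k≥0} (−2iτβ)^k/(k+1)!` (i.e. `(1 − exp(−2iτβ))/(2iτβ)`) is Hermitian and
`v* M v` is real and strictly positive for every nonzero `v ∈ ℂⁿ`. -/
theorem stmt_2 (n : ℕ) (β : Matrix (Fin n) (Fin n) ℝ) (hβ : β.transpose = -β)
    (τ : ℝ) (hτ : 0 < τ)
    (M : Matrix (Fin n) (Fin n) ℂ)
    (hM : M = ∑' k : ℕ, (((k + 1)! : ℂ))⁻¹ •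
        (((-2 * Complex.I * (τ : ℂ)) • β.map ((↑) : ℝ → ℂ)) ^ k)) :
    M.IsHermitian ∧
      ∀ v : Fin n → ℂ, v ≠ 0 →
        ((star v) ⬝ᵥ (M *ᵥ v)).im = 0 ∧ 0 < ((star v) ⬝ᵥ (M *ᵥ v)).re := by
  have hH : ((-2 * Complex.I * (τ : ℂ)) • β.map ((↑) : ℝ → ℂ)).IsHermitian := by
    ext i j
    have hij : β j i = -β i j := congrFun (congrFun hβ i) j
    simp [hij]
  have hpos : M.PosDef := by
    rw [hM]
    convert hH.posDef_tsum_smul_pow exists_pos_hasSum_inv_factorial_succ_mul_pow using 4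
    simp
  refine ⟨hpos.isHermitian, fun v hv => ?_⟩
  have h := Complex.pos_iff.1 (hpos.dotProduct_mulVec_pos hv)
  exact ⟨h.2.symm, h.1⟩
end

section
/- Let U ⊆ ℂⁿ be open and let F : ℂⁿ → ℂⁿ be holomorphic on U. Let R > 0 and suppose z : ℂ → ℂⁿ is differentiable on the open disk D_R = {t ∈ ℂ : |t| < R}, satisfies z'(t) = F(z(t)) for all |t| < R, and there is a compact set K ⊆ U with z(t) ∈ K for all |t| < R. Then there exist S > R and a function w : ℂ → ℂⁿ, differentiable on D_S, with w(t) = z(t) for all |t| < R, w(t) ∈ U for all |t| < S, and w'(t) = F(w(t)) for all |t| < S. -/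
open Metric Filter Topology

section HolomorphicODE

variable {E : Type*} [NormedAddCommGroup E] [NormedSpace ℂ E]

/-- Cauchy estimate: a bounded holomorphic map is Lipschitz on a ball of half the radius. -/
theorem norm_sub_le_of_differentiableOn_of_norm_le {F : E → E} {x : E} {δ M : ℝ} (hδ : 0 < δ)
    (hF : DifferentiableOn ℂ F (ball x (2 * δ))) (hM : ∀ y ∈ ball x (2 * δ), ‖F y‖ ≤ M)
    {a b : E} (ha : a ∈ ball x δ) (hb : b ∈ ball x δ) :
    ‖F a - F b‖ ≤ M / δ * ‖a - b‖ := by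
  have hM0 : 0 ≤ M := (norm_nonneg _).trans (hM x (mem_ball_self (by positivity)))
  have hdiff : ∀ y ∈ ball x (2 * δ), DifferentiableAt ℂ F y := fun y hy ↦
    (hF y hy).differentiableAt (isOpen_ball.mem_nhds hy)
  have hsub : ball x δ ⊆ ball x (2 * δ) := ball_subset_ball (by linarith)
  let _ : NormedSpace ℝ E := NormedSpace.restrictScalars ℝ ℂ E
  refine Convex.norm_image_sub_le_of_norm_fderiv_le (𝕜 := ℂ) (fun y hy ↦ hdiff y (hsub hy))
    (fun y hy ↦ ?_) (convex_ball x δ) hb ha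
  refine ContinuousLinearMap.opNorm_le_bound _ (by positivity) fun v ↦ ?_
  rcases eq_or_ne v 0 with rfl | hv
  · simp
  have hv' : 0 < ‖v‖ := norm_pos_iff.2 hv
  have hmem : ∀ s ∈ closedBall (0 : ℂ) (δ / ‖v‖), y + s • v ∈ ball x (2 * δ) := by
    intro s hs
    rw [mem_closedBall_zero_iff, le_div_iff₀ hv', ← norm_smul] at hs
    rw [mem_ball] at hy ⊢
    calc dist (y + s • v) x ≤ dist (y + s • v) y + dist y x := dist_triangle _ _ _
      _ < 2 * δ := by rw [dist_self_add_left]; linarith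
  have hline : ∀ s : ℂ, HasDerivAt (fun s : ℂ ↦ y + s • v) v s := fun s ↦ by
    simpa using ((hasDerivAt_id s).smul_const v).const_add y
  have hd : DifferentiableOn ℂ (fun s : ℂ ↦ F (y + s • v)) (closedBall 0 (δ / ‖v‖)) := fun s hs ↦
    ((hdiff _ (hmem s hs)).comp s (hline s).differentiableAt).differentiableWithinAt
  have hderiv : deriv (fun s : ℂ ↦ F (y + s • v)) 0 = fderiv ℂ F y v := by
    have hFy : HasFDerivAt F (fderiv ℂ F y) (y + (0 : ℂ) • v) := by
      simpa using (hdiff y (hsub hy)).hasFDerivAt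
    exact (hFy.comp_hasDerivAt (0 : ℂ) (hline 0)).deriv
  have hpos : 0 < δ / ‖v‖ := by positivity
  have := Complex.norm_deriv_le_of_forall_mem_sphere_norm_le hpos
    (DifferentiableOn.diffContOnCl (by rwa [closure_ball _ hpos.ne']))
    (fun s hs ↦ hM _ (hmem s (sphere_subset_closedBall hs)))
  rw [hderiv] at this
  exact this.trans_eq (by field_simp)

theorem norm_sub_center_le_of_hasDerivAt_ball {g g' : ℂ → E} {c t : ℂ} {r B : ℝ}
    (hg : ∀ s ∈ ball c r, HasDerivAt g (g' s) s) (hB : ∀ s ∈ ball c r, ‖g' s‖ ≤ B)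
    (ht : t ∈ ball c r) : ‖g t - g c‖ ≤ B * r := by
  have hr : 0 < r := pos_of_mem_ball ht
  have hc : c ∈ ball c r := mem_ball_self hr
  have hB0 : 0 ≤ B := (norm_nonneg _).trans (hB c hc)
  refine (Convex.norm_image_sub_le_of_norm_hasDerivWithin_le
    (fun s hs ↦ (hg s hs).hasDerivWithinAt) hB (convex_ball c r) hc ht).trans ?_
  gcongr
  exact (mem_ball_iff_norm.1 ht).le

/-- Uniqueness on a small disk for a complex-time ODE with Lipschitz right-hand side. -/
theorem eqOn_ball_of_hasDerivAt_of_lipschitz {F : E → E} {x : E} {η L : ℝ} {c : ℂ} {r : ℝ}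
    (hL0 : 0 ≤ L)
    (hL : ∀ a ∈ closedBall x η, ∀ b ∈ closedBall x η, ‖F a - F b‖ ≤ L * ‖a - b‖)
    (hLr : L * r ≤ 1 / 2) {u v : ℂ → E}
    (hu : ∀ t ∈ ball c r, HasDerivAt u (F (u t)) t) (hux : ∀ t ∈ ball c r, u t ∈ closedBall x η)
    (hv : ∀ t ∈ ball c r, HasDerivAt v (F (v t)) t) (hvx : ∀ t ∈ ball c r, v t ∈ closedBall x η)
    (huv : u c = v c) : Set.EqOn u v (ball c r) := by
  have key : ∀ n : ℕ, ∀ t ∈ ball c r, ‖u t - v t‖ ≤ 2 * η * (1 / 2) ^ n := by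
    intro n
    induction n with
    | zero =>
      intro t ht
      have h1 := mem_closedBall.1 (hux t ht)
      have h2 := mem_closedBall.1 (hvx t ht)
      have := dist_triangle_right (u t) (v t) x
      rw [← dist_eq_norm]
      linarith
    | succ n ih =>
      intro t ht
      have hr : 0 < r := pos_of_mem_ball ht
      have h := norm_sub_center_le_of_hasDerivAt_ball (g := fun s ↦ u s - v s)
        (B := L * (2 * η * (1 / 2) ^ n)) (fun s hs ↦ (hu s hs).sub (hv s hs))
        (fun s hs ↦ (hL _ (hux s hs) _ (hvx s hs)).trans (by gcongr; exact ih s hs)) ht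
      simp only [huv, sub_self, sub_zero] at h
      have h0 : 0 ≤ 2 * η * (1 / 2) ^ n := (norm_nonneg _).trans (ih t ht)
      calc ‖u t - v t‖ ≤ (L * r) * (2 * η * (1 / 2) ^ n) := h.trans_eq (by ring)
        _ ≤ 1 / 2 * (2 * η * (1 / 2) ^ n) := by gcongr
        _ = _ := by ring
  intro t ht
  have hlim : Tendsto (fun n : ℕ ↦ 2 * η * (1 / 2 : ℝ) ^ n) atTop (𝓝 (2 * η * 0)) :=
    (tendsto_pow_atTop_nhds_zero_of_lt_one (by norm_num) (by norm_num)).const_mul _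
  rw [mul_zero] at hlim
  have := ge_of_tendsto' hlim fun n ↦ key n t ht
  exact sub_eq_zero.1 (norm_le_zero_iff.1 this)

/-- Holomorphic Picard–Lindelöf theorem, by Picard iteration on a disk. -/
theorem exists_hasDerivAt_ball_of_lipschitz [CompleteSpace E] {F : E → E} {x : E} {δ η L M : ℝ}
    {r : ℝ} (c : ℂ) (hη : 0 ≤ η) (hηδ : η < δ) (hF : DifferentiableOn ℂ F (ball x δ))
    (hM : ∀ y ∈ ball x δ, ‖F y‖ ≤ M) (hL0 : 0 ≤ L)
    (hL : ∀ a ∈ closedBall x η, ∀ b ∈ closedBall x η, ‖F a - F b‖ ≤ L * ‖a - b‖)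
    (hr : 0 < r) (hMr : M * r ≤ η) (hLr : L * r ≤ 1 / 2) :
    ∃ w : ℂ → E, w c = x ∧ (∀ t ∈ ball c r, w t ∈ closedBall x η) ∧
      ∀ t ∈ ball c r, HasDerivAt w (F (w t)) t := by
  have hsub : closedBall x η ⊆ ball x δ := closedBall_subset_ball hηδ
  let X := {u : ℂ → E // DifferentiableOn ℂ u (ball c r) ∧ ∀ t ∈ ball c r, u t ∈ closedBall x η}
  have step : ∀ u : X, ∃ v : X, v.1 c = x ∧ ∀ t ∈ ball c r, HasDerivAt v.1 (F (u.1 t)) t := by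
    rintro ⟨u, hud, hux⟩
    have hFu : DifferentiableOn ℂ (fun t ↦ F (u t)) (ball c r) :=
      hF.comp hud fun t ht ↦ hsub (hux t ht)
    obtain ⟨v, hvc, hv⟩ := hFu.isExactOn_ball.with_val_at c x
    refine ⟨⟨v, fun t ht ↦ (hv t ht).differentiableAt.differentiableWithinAt, fun t ht ↦ ?_⟩,
      hvc, hv⟩
    rw [mem_closedBall_iff_norm, ← hvc]
    exact (norm_sub_center_le_of_hasDerivAt_ball hv
      (fun s hs ↦ hM _ (hsub (hux s hs))) ht).trans hMr
  choose P hPc hP using step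
  let u₀ : X := ⟨fun _ ↦ x, differentiableOn_const x, fun t _ ↦ mem_closedBall_self hη⟩
  let u : ℕ → X := fun n ↦ P^[n] u₀
  have hu : ∀ n, u (n + 1) = P (u n) := fun n ↦ Function.iterate_succ_apply' P n u₀
  have hdist : ∀ t ∈ ball c r, ∀ n, dist ((u n).1 t) ((u (n + 1)).1 t) ≤ η * (1 / 2) ^ n := by
    intro t ht n
    induction n generalizing t with
    | zero =>
      simpa [u, u₀, dist_comm] using mem_closedBall.1 ((u 1).2.2 t ht)
    | succ n ih =>
      have h := norm_sub_center_le_of_hasDerivAt_ball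
        (g := fun s ↦ (u (n + 1)).1 s - (u (n + 2)).1 s) (B := L * (η * (1 / 2) ^ n))
        (fun s hs ↦ by
          rw [hu (n + 1)]
          exact (hu n ▸ hP (u n) s hs).sub (hP (u (n + 1)) s hs))
        (fun s hs ↦ (hL _ ((u n).2.2 s hs) _ ((u (n + 1)).2.2 s hs)).trans (by
          gcongr
          exact dist_eq_norm ((u n).1 s) _ ▸ ih s hs)) ht
      have hc : (u (n + 1)).1 c - (u (n + 2)).1 c = 0 := by
        rw [hu (n + 1), hPc, hu n, hPc, sub_self]
      rw [hc, sub_zero, ← dist_eq_norm] at h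
      calc dist ((u (n + 1)).1 t) ((u (n + 2)).1 t) ≤ (L * r) * (η * (1 / 2) ^ n) :=
            h.trans_eq (by ring)
        _ ≤ 1 / 2 * (η * (1 / 2) ^ n) := by gcongr
        _ = _ := by ring
  have hlim : ∀ t, ∃ y, t ∈ ball c r → Tendsto (fun n ↦ (u n).1 t) atTop (𝓝 y) := by
    intro t
    by_cases ht : t ∈ ball c r
    · obtain ⟨y, hy⟩ := cauchySeq_tendsto_of_complete
        (cauchySeq_of_le_geometric _ _ (by norm_num) (hdist t ht))
      exact ⟨y, fun _ ↦ hy⟩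
    · exact ⟨x, fun h ↦ absurd h ht⟩
  choose w hw using hlim
  have hwx : ∀ t ∈ ball c r, w t ∈ closedBall x η := fun t ht ↦
    isClosed_closedBall.mem_of_tendsto (hw t ht) (.of_forall fun n ↦ (u n).2.2 t ht)
  have hunif : TendstoUniformlyOn (fun n ↦ (u n).1) w atTop (ball c r) := by
    have hgeom : Tendsto (fun n : ℕ ↦ η * (1 / 2 : ℝ) ^ n / (1 - 1 / 2)) atTop
        (𝓝 (η * 0 / (1 - 1 / 2))) :=
      ((tendsto_pow_atTop_nhds_zero_of_lt_one (by norm_num) (by norm_num)).const_mul _).div_const _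
    rw [mul_zero, zero_div] at hgeom
    refine Metric.tendstoUniformlyOn_iff.2 fun ε hε ↦ ?_
    filter_upwards [hgeom.eventually_lt_const hε] with n hn t ht
    rw [dist_comm]
    exact (dist_le_of_le_geometric_of_tendsto _ _ (by norm_num) (hdist t ht) (hw t ht) n).trans_lt hn
  have hloc := hunif.tendstoLocallyUniformlyOn
  have hdiff : ∀ᶠ n in atTop, DifferentiableOn ℂ (u n).1 (ball c r) := .of_forall fun n ↦ (u n).2.1
  have hwd := hloc.differentiableOn hdiff isOpen_ball
  refine ⟨w, ?_, hwx, fun t ht ↦ ?_⟩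
  · refine tendsto_nhds_unique ((tendsto_add_atTop_iff_nat 1).2 (hw c (mem_ball_self hr))) ?_
    simp only [hu, hPc, tendsto_const_nhds]
  · have h1 : Tendsto (fun n ↦ deriv (u (n + 1)).1 t) atTop (𝓝 (deriv w t)) :=
      (tendsto_add_atTop_iff_nat 1).2 ((hloc.deriv hdiff isOpen_ball).tendsto_at ht)
    have hFc : ContinuousAt F (w t) :=
      hF.continuousOn.continuousAt (isOpen_ball.mem_nhds (hsub (hwx t ht)))
    have h2 : Tendsto (fun n ↦ F ((u n).1 t)) atTop (𝓝 (F (w t))) := hFc.tendsto.comp (hw t ht)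
    have h3 : (fun n ↦ deriv (u (n + 1)).1 t) = fun n ↦ F ((u n).1 t) := by
      funext n
      rw [hu n]
      exact (hP (u n) t ht).deriv
    rw [h3] at h1
    rw [← tendsto_nhds_unique h1 h2]
    exact (hwd.differentiableAt (isOpen_ball.mem_nhds ht)).hasDerivAt

theorem eqOn_inter_ball_of_eventuallyEq [CompleteSpace E] {f g : ℂ → E} {c₁ c₂ : ℂ} {r₁ r₂ : ℝ}
    (hf : DifferentiableOn ℂ f (ball c₁ r₁)) (hg : DifferentiableOn ℂ g (ball c₂ r₂)) {s : ℂ}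
    (hs : s ∈ ball c₁ r₁ ∩ ball c₂ r₂) (hfg : f =ᶠ[𝓝 s] g) :
    Set.EqOn f g (ball c₁ r₁ ∩ ball c₂ r₂) :=
  have ho : IsOpen (ball c₁ r₁ ∩ ball c₂ r₂) := isOpen_ball.inter isOpen_ball
  ((hf.mono Set.inter_subset_left).analyticOnNhd ho).eqOn_of_preconnected_of_eventuallyEq
    ((hg.mono Set.inter_subset_right).analyticOnNhd ho)
    ((convex_ball _ _).inter (convex_ball _ _)).isPreconnected hs hfg

/-- Local solutions on disks of a common radius centred in a disk, all agreeing with a given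
solution near their centres, glue to a solution on a larger disk. -/
theorem exists_extension_of_uniform_local_solutions [CompleteSpace E] {U : Set E} {F : E → E}
    {z : ℂ → E} {R r : ℝ} (hR : 0 < R) (hr : 0 < r)
    (hz : DifferentiableOn ℂ z (ball 0 R))
    (h : ∀ c ∈ ball (0 : ℂ) R, ∃ w : ℂ → E, w =ᶠ[𝓝 c] z ∧ (∀ t ∈ ball c r, w t ∈ U) ∧
      ∀ t ∈ ball c r, HasDerivAt w (F (w t)) t) :
    ∃ S : ℝ, R < S ∧ ∃ w : ℂ → E, (∀ t ∈ ball (0 : ℂ) R, w t = z t) ∧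
      (∀ t ∈ ball (0 : ℂ) S, w t ∈ U) ∧ ∀ t ∈ ball (0 : ℂ) S, HasDerivAt w (F (w t)) t := by
  choose! W hWz hWU hW using h
  have hWd : ∀ c ∈ ball (0 : ℂ) R, DifferentiableOn ℂ (W c) (ball c r) := fun c hc t ht ↦
    (hW c hc t ht).differentiableAt.differentiableWithinAt
  have heqz : ∀ c ∈ ball (0 : ℂ) R, Set.EqOn (W c) z (ball c r ∩ ball 0 R) := fun c hc ↦
    eqOn_inter_ball_of_eventuallyEq (hWd c hc) hz ⟨mem_ball_self hr, hc⟩ (hWz c hc)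
  have heq : ∀ a ∈ ball (0 : ℂ) R, ∀ b ∈ ball (0 : ℂ) R,
      Set.EqOn (W a) (W b) (ball a r ∩ ball b r) := by
    intro a ha b hb t ht
    have hab : dist a b < 2 * r := by
      linarith [dist_triangle_left a b t, mem_ball.1 ht.1, mem_ball.1 ht.2]
    have hma : midpoint ℝ a b ∈ ball a r := by
      rw [mem_ball, dist_midpoint_left]
      norm_num
      linarith
    have hmb : midpoint ℝ a b ∈ ball b r := by
      rw [mem_ball, dist_midpoint_right]
      norm_num
      linarith
    have hm : midpoint ℝ a b ∈ ball (0 : ℂ) R :=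
      (convex_ball (0 : ℂ) R).segment_subset ha hb (midpoint_mem_segment a b)
    refine eqOn_inter_ball_of_eventuallyEq (hWd a ha) (hWd b hb) ⟨hma, hmb⟩ ?_ ht
    filter_upwards [isOpen_ball.mem_nhds hma, isOpen_ball.mem_nhds hmb, isOpen_ball.mem_nhds hm]
      with s hsa hsb hs
    exact (heqz a ha ⟨hsa, hs⟩).trans (heqz b hb ⟨hsb, hs⟩).symm
  have hS : 0 < R + r := by positivity
  let p : ℂ → ℂ := fun t ↦ (R / (R + r)) • t
  have hp : ∀ t ∈ ball (0 : ℂ) (R + r), p t ∈ ball (0 : ℂ) R ∧ t ∈ ball (p t) r := by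
    intro t ht
    rw [mem_ball_zero_iff] at ht
    constructor
    · rw [mem_ball_zero_iff, norm_smul, Real.norm_of_nonneg (by positivity)]
      calc R / (R + r) * ‖t‖ < R / (R + r) * (R + r) := by gcongr
        _ = R := by field_simp
    · have : t - p t = (r / (R + r)) • t := by
        rw [show r / (R + r) = 1 - R / (R + r) by field_simp; ring, sub_smul, one_smul]
      rw [mem_ball_iff_norm, this, norm_smul, Real.norm_of_nonneg (by positivity)]
      calc r / (R + r) * ‖t‖ < r / (R + r) * (R + r) := by gcongr
        _ = r := by field_simp
  refine ⟨R + r, by linarith, fun t ↦ W (p t) t, fun t ht ↦ ?_, fun t ht ↦ ?_, fun t ht ↦ ?_⟩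
  · obtain ⟨h1, h2⟩ := hp t (ball_subset_ball (by linarith) ht)
    exact heqz _ h1 ⟨h2, ht⟩
  · obtain ⟨h1, h2⟩ := hp t ht
    exact hWU _ h1 t h2
  · obtain ⟨h1, h2⟩ := hp t ht
    refine (hW _ h1 t h2).congr_of_eventuallyEq ?_
    filter_upwards [isOpen_ball.mem_nhds ht, isOpen_ball.mem_nhds h2] with s hs hst
    obtain ⟨h3, h4⟩ := hp s hs
    exact heq _ h3 _ h1 ⟨h4, hst⟩

end HolomorphicODE

/-- If a solution of the holomorphic ODE `z' = F(z)` on the disk `D_R` stays in a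
compact subset `K` of the domain `U` of `F`, then it extends to a solution on a
strictly larger disk `D_S`. -/
theorem stmt_3 (n : ℕ) (U : Set (EuclideanSpace ℂ (Fin n))) (hU : IsOpen U)
    (F : EuclideanSpace ℂ (Fin n) → EuclideanSpace ℂ (Fin n))
    (hF : DifferentiableOn ℂ F U)
    (R : ℝ) (hR : 0 < R)
    (z : ℂ → EuclideanSpace ℂ (Fin n))
    (hz : ∀ t ∈ Metric.ball (0 : ℂ) R, HasDerivAt z (F (z t)) t)
    (K : Set (EuclideanSpace ℂ (Fin n))) (hK : IsCompact K) (hKU : K ⊆ U)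
    (hzK : ∀ t ∈ Metric.ball (0 : ℂ) R, z t ∈ K) :
    ∃ S : ℝ, R < S ∧ ∃ w : ℂ → EuclideanSpace ℂ (Fin n),
      (∀ t ∈ Metric.ball (0 : ℂ) R, w t = z t) ∧
      (∀ t ∈ Metric.ball (0 : ℂ) S, w t ∈ U) ∧
      (∀ t ∈ Metric.ball (0 : ℂ) S, HasDerivAt w (F (w t)) t) := by
  obtain ⟨ε, hε, hεU⟩ := hK.exists_cthickening_subset_open hU hKU
  obtain ⟨M₀, hM₀⟩ := (hK.cthickening (r := ε)).exists_bound_of_continuousOn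
    (hF.continuousOn.mono hεU)
  obtain ⟨M, hM, hMF⟩ : ∃ M > 0, ∀ y ∈ cthickening ε K, ‖F y‖ ≤ M :=
    ⟨max M₀ 1, by positivity, fun y hy ↦ (hM₀ y hy).trans (le_max_left _ _)⟩
  obtain ⟨δ, rfl⟩ : ∃ δ, ε = 2 * δ := ⟨ε / 2, by ring⟩
  have hδ : 0 < δ := by linarith
  have hball : ∀ x ∈ K, ball x (2 * δ) ⊆ cthickening (2 * δ) K := fun x hx ↦
    ball_subset_closedBall.trans (closedBall_subset_cthickening hx _)
  have hr : 0 < δ / (2 * M) := by positivity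
  have hMr : M * (δ / (2 * M)) = δ / 2 := by field_simp
  have hLr : M / δ * (δ / (2 * M)) = 1 / 2 := by field_simp
  have hL : ∀ x ∈ K, ∀ a ∈ closedBall x (δ / 2), ∀ b ∈ closedBall x (δ / 2),
      ‖F a - F b‖ ≤ M / δ * ‖a - b‖ := fun x hx a ha b hb ↦
    norm_sub_le_of_differentiableOn_of_norm_le hδ (hF.mono ((hball x hx).trans hεU))
      (fun y hy ↦ hMF y (hball x hx hy)) (closedBall_subset_ball (by linarith) ha)
      (closedBall_subset_ball (by linarith) hb)
  refine exists_extension_of_uniform_local_solutions hR hr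
    (fun t ht ↦ (hz t ht).differentiableAt.differentiableWithinAt) fun c hc ↦ ?_
  have hcK := hzK c hc
  obtain ⟨w, hwc, hwx, hw⟩ := exists_hasDerivAt_ball_of_lipschitz c (η := δ / 2) (by positivity)
    (by linarith) (hF.mono ((hball _ hcK).trans hεU)) (fun y hy ↦ hMF y (hball _ hcK hy))
    (by positivity) (hL _ hcK) hr hMr.le hLr.le
  refine ⟨w, ?_, fun t ht ↦ hεU (hball _ hcK (closedBall_subset_ball (by linarith) (hwx t ht))), hw⟩
  obtain ⟨ρ, hρ, hρsub⟩ := Metric.isOpen_iff.1 (isOpen_ball.inter isOpen_ball) c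
    (⟨mem_ball_self hr, hc⟩ : c ∈ ball c (δ / (2 * M)) ∩ ball 0 R)
  have hmin : ball c (min ρ (δ / (2 * M))) ⊆ ball c ρ := ball_subset_ball (min_le_left _ _)
  have hzx : ∀ t ∈ ball c (min ρ (δ / (2 * M))), z t ∈ closedBall (z c) (δ / 2) := by
    intro t ht
    rw [mem_closedBall_iff_norm, ← hMr]
    refine (norm_sub_center_le_of_hasDerivAt_ball (fun s hs ↦ hz s (hρsub (hmin hs)).2)
      (fun s hs ↦ hMF _ (self_subset_cthickening K (hzK s (hρsub (hmin hs)).2))) ht).trans ?_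
    gcongr
    exact min_le_right _ _
  have heq : Set.EqOn w z (ball c (min ρ (δ / (2 * M)))) := by
    refine eqOn_ball_of_hasDerivAt_of_lipschitz (L := M / δ) (by positivity) (hL _ hcK) ?_
      (fun t ht ↦ hw t (hρsub (hmin ht)).1) (fun t ht ↦ hwx t (hρsub (hmin ht)).1)
      (fun t ht ↦ hz t (hρsub (hmin ht)).2) hzx hwc
    rw [← hLr]
    gcongr
    exact min_le_right _ _
  exact heq.eventuallyEq_of_mem (ball_mem_nhds c (lt_min hρ hr))
end

section
/- Let z₀ ∈ ℂⁿ, A > 0, C > 0, and let F : ℂⁿ → ℂⁿ be holomorphic on the open ball B(z₀, A) with F(z₀) = 0 and ‖F(z)‖ ≤ C‖z − z₀‖ for all z ∈ B(z₀, A). Then for every w ∈ B(z₀, A) with w ≠ z₀, setting T = (1/C)·log(A/‖w − z₀‖), there exists a function z : ℂ → ℂⁿ, differentiable on the open disk D_T = {t ∈ ℂ : |t| < T}, with z(0) = w, z(t) ∈ B(z₀, A) for all |t| < T, and z'(t) = F(z(t)) for all |t| < T. -/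
open Metric Filter Topology in
/-- A Grönwall-type bound along rays: integrating `‖f'(t)‖ ≤ a K e^{K|t|}` from the centre of a
disk gives `‖f(t)‖ ≤ a e^{K|t|}`. -/
lemma norm_le_mul_exp_of_norm_hasDerivAt_le {E : Type*} [NormedAddCommGroup E] [NormedSpace ℂ E]
    {f f' : ℂ → E} {T a K : ℝ} (h0 : ‖f 0‖ ≤ a)
    (hd : ∀ t ∈ ball (0 : ℂ) T, HasDerivAt f (f' t) t)
    (hb : ∀ t ∈ ball (0 : ℂ) T, ‖f' t‖ ≤ a * (K * Real.exp (K * ‖t‖)))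
    {t : ℂ} (ht : t ∈ ball (0 : ℂ) T) : ‖f t‖ ≤ a * Real.exp (K * ‖t‖) := by
  let _ : NormedSpace ℝ E := NormedSpace.restrictScalars ℝ ℂ E
  have hmem : ∀ s ∈ Set.Icc (0 : ℝ) 1, (s : ℂ) * t ∈ ball (0 : ℂ) T := by
    intro s hs
    rw [mem_ball_zero_iff] at ht ⊢
    rw [norm_mul, Complex.norm_real, Real.norm_of_nonneg hs.1]
    nlinarith [hs.2, norm_nonneg t]
  have hderiv : ∀ s ∈ Set.Icc (0 : ℝ) 1,
      HasDerivAt (fun s : ℝ ↦ f ((s : ℂ) * t)) (t • f' ((s : ℂ) * t)) s := by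
    intro s hs
    have h := HasDerivAt.scomp s (hd _ (hmem s hs))
      ((Complex.ofRealCLM.hasDerivAt (x := s)).mul_const t)
    simpa [Function.comp_def] using h
  have hB : ∀ s : ℝ, HasDerivAt (fun s : ℝ ↦ a * Real.exp (K * (s * ‖t‖)))
      (a * (Real.exp (K * (s * ‖t‖)) * (K * ‖t‖))) s := by
    intro s
    simpa using ((((hasDerivAt_id s).mul_const ‖t‖).const_mul K).exp).const_mul a
  have key := image_norm_le_of_norm_deriv_right_le_deriv_boundary
    (f := fun s : ℝ ↦ f ((s : ℂ) * t)) (a := 0) (b := 1)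
    (fun s hs ↦ (hderiv s hs).continuousAt.continuousWithinAt)
    (fun s hs ↦ (hderiv s (Set.Ico_subset_Icc_self hs)).hasDerivWithinAt)
    (by simpa using h0) hB
    (fun s hs ↦ by
      have h := hb _ (hmem s (Set.Ico_subset_Icc_self hs))
      rw [norm_mul, Complex.norm_real, Real.norm_of_nonneg hs.1] at h
      rw [norm_smul]
      calc ‖t‖ * ‖f' (s * t)‖ ≤ ‖t‖ * (a * (K * Real.exp (K * (s * ‖t‖)))) := by gcongr
        _ = _ := by ring)
    (Set.right_mem_Icc.2 zero_le_one)
  simpa using key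

open Metric in
/-- A bounded holomorphic map on a ball is Lipschitz on every smaller concentric ball. -/
lemma exists_norm_sub_le_of_differentiableOn_ball {E G : Type*} [NormedAddCommGroup E]
    [NormedSpace ℂ E] [NormedAddCommGroup G] [NormedSpace ℂ G] {F : E → G} {c : E} {R A M : ℝ}
    (hRA : R < A) (hF : DifferentiableOn ℂ F (ball c A)) (hM : ∀ x ∈ ball c A, ‖F x‖ ≤ M) :
    ∃ L > 0, ∀ x ∈ closedBall c R, ∀ y ∈ closedBall c R, ‖F y - F x‖ ≤ L * ‖y - x‖ := by
  let _ : NormedSpace ℝ E := NormedSpace.restrictScalars ℝ ℂ E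
  have hpos : 0 < A - R := sub_pos.2 hRA
  have hsub : closedBall c R ⊆ ball c A := closedBall_subset_ball hRA
  refine ⟨max ((M + M) / (A - R)) 1, by positivity, fun x hx y hy ↦ ?_⟩
  refine Convex.norm_image_sub_le_of_norm_fderiv_le (𝕜 := ℂ) (s := closedBall c R)
    (fun u hu ↦ hF.differentiableAt (isOpen_ball.mem_nhds (hsub hu))) (fun u hu ↦ ?_)
    (convex_closedBall c R) hx hy
  have hball : ball u (A - R) ⊆ ball c A :=
    ball_subset_ball' (by linarith [mem_closedBall.1 hu])
  refine (Complex.norm_fderiv_le_div_of_mapsTo_ball (hF.mono hball) (fun v hv ↦ ?_) hpos).trans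
    (le_max_left _ _)
  rw [mem_closedBall, dist_eq_norm]
  exact (norm_sub_le _ _).trans (add_le_add (hM v (hball hv)) (hM u (hsub hu)))

open Metric Filter Topology in
/-- Picard iterates of a Lipschitz vector field on a complex disk converge to a solution. -/
lemma hasDerivAt_limUnder_picard_iterates {E : Type*} [NormedAddCommGroup E]
    [NormedSpace ℂ E] [CompleteSpace E] {F : E → E} {c : E} {T R L : ℝ} (hL : 0 < L)
    (hLip : ∀ x ∈ closedBall c R, ∀ y ∈ closedBall c R, ‖F y - F x‖ ≤ L * ‖y - x‖)
    {z : ℕ → ℂ → E} (h0 : ∀ k, z k 0 = z 0 0)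
    (hmem : ∀ k, ∀ t ∈ ball (0 : ℂ) T, z k t ∈ closedBall c R)
    (hd : ∀ k, ∀ t ∈ ball (0 : ℂ) T, HasDerivAt (z (k + 1)) (F (z k t)) t)
    {t : ℂ} (ht : t ∈ ball (0 : ℂ) T) :
    Tendsto (fun k ↦ z k t) atTop (𝓝 (limUnder atTop fun k ↦ z k t)) ∧
      HasDerivAt (fun s ↦ limUnder atTop fun k ↦ z k s) (F (limUnder atTop fun k ↦ z k t)) t := by
  have hR : 0 ≤ R := dist_nonneg.trans (mem_closedBall.1 (hmem 0 t ht))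
  have hdiff : ∀ k, ∀ s ∈ ball (0 : ℂ) T,
      ‖z (k + 1) s - z k s‖ ≤ (R + R) / 2 ^ k * Real.exp (2 * L * ‖s‖) := by
    intro k
    induction k with
    | zero =>
      intro s hs
      calc ‖z (0 + 1) s - z 0 s‖ ≤ R + R := by
            rw [← dist_eq_norm]
            exact (dist_triangle_right _ _ c).trans (add_le_add (hmem _ s hs) (hmem _ s hs))
        _ ≤ (R + R) * Real.exp (2 * L * ‖s‖) :=
            le_mul_of_one_le_right (by positivity) (Real.one_le_exp (by positivity))
        _ = _ := by simp
    | succ k ih =>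
      intro s hs
      refine norm_le_mul_exp_of_norm_hasDerivAt_le (f := fun u ↦ z (k + 1 + 1) u - z (k + 1) u)
        ?_ (fun u hu ↦ (hd (k + 1) u hu).sub (hd k u hu)) (fun u hu ↦ ?_) hs
      · rw [h0, h0 (k + 1), sub_self, norm_zero]
        positivity
      · calc ‖F (z (k + 1) u) - F (z k u)‖ ≤ L * ‖z (k + 1) u - z k u‖ :=
              hLip _ (hmem k u hu) _ (hmem (k + 1) u hu)
          _ ≤ L * ((R + R) / 2 ^ k * Real.exp (2 * L * ‖u‖)) := by gcongr; exact ih u hu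
          _ = _ := by rw [pow_succ]; field_simp
  set D := 2 * ((R + R) * Real.exp (2 * L * T)) with hD
  have hgeom : ∀ s ∈ ball (0 : ℂ) T, ∀ k, dist (z k s) (z (k + 1) s) ≤ D / 2 / 2 ^ k := by
    intro s hs k
    rw [dist_comm, dist_eq_norm]
    calc ‖z (k + 1) s - z k s‖ ≤ (R + R) / 2 ^ k * Real.exp (2 * L * ‖s‖) := hdiff k s hs
      _ ≤ (R + R) / 2 ^ k * Real.exp (2 * L * T) := by
          gcongr
          exact (mem_ball_zero_iff.1 hs).le
      _ = _ := by rw [hD]; field_simp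
  have hlim : ∀ s ∈ ball (0 : ℂ) T,
      Tendsto (fun k ↦ z k s) atTop (𝓝 (limUnder atTop fun k ↦ z k s)) :=
    fun s hs ↦ (cauchySeq_of_le_geometric_two (hgeom s hs)).tendsto_limUnder
  have hlim_mem : ∀ s ∈ ball (0 : ℂ) T, (limUnder atTop fun k ↦ z k s) ∈ closedBall c R :=
    fun s hs ↦ isClosed_closedBall.mem_of_tendsto (hlim s hs)
      (Eventually.of_forall fun k ↦ hmem k s hs)
  refine ⟨hlim t ht, ?_⟩
  refine hasDerivAt_of_tendstoLocallyUniformlyOn (l := atTop) (f := fun k ↦ z (k + 1))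
    (f' := fun k s ↦ F (z k s)) (g' := fun s ↦ F (limUnder atTop fun k ↦ z k s))
    isOpen_ball (TendstoUniformlyOn.tendstoLocallyUniformlyOn ?_)
    (Eventually.of_forall hd) (fun s hs ↦ (hlim s hs).comp (tendsto_add_atTop_nat 1)) ht
  rw [Metric.tendstoUniformlyOn_iff]
  intro ε hε
  have hsmall : Tendsto (fun k : ℕ ↦ L * (D / 2 ^ k)) atTop (𝓝 0) := by
    have h := (tendsto_pow_atTop_nhds_zero_of_lt_one (r := (1 / 2 : ℝ)) (by norm_num)
      (by norm_num)).const_mul (L * D)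
    simpa [div_eq_mul_inv, mul_assoc] using h
  filter_upwards [hsmall.eventually_lt_const hε] with k hk s hs
  refine lt_of_le_of_lt ?_ hk
  rw [dist_eq_norm]
  refine (hLip _ (hmem k s hs) _ (hlim_mem s hs)).trans ?_
  gcongr
  rw [← dist_eq_norm, dist_comm]
  exact dist_le_of_le_geometric_two_of_tendsto (hgeom s hs) (hlim s hs) k

open Metric Filter Topology in
/-- A holomorphic vector field of linear growth on a ball has Picard iterates defined on a whole
disk, where they satisfy the exponential growth bound. -/
lemma exists_picard_iterates {E : Type*} [NormedAddCommGroup E] [NormedSpace ℂ E]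
    [CompleteSpace E] {F : E → E} {c w : E} {A C T : ℝ} (hC : 0 ≤ C)
    (hF : DifferentiableOn ℂ F (ball c A)) (hFC : ∀ x ∈ ball c A, ‖F x‖ ≤ C * ‖x - c‖)
    (hT : ∀ t ∈ ball (0 : ℂ) T, ‖w - c‖ * Real.exp (C * ‖t‖) < A) :
    ∃ z : ℕ → ℂ → E, (∀ k, z k 0 = w) ∧
      (∀ k, ∀ t ∈ ball (0 : ℂ) T, ‖z k t - c‖ ≤ ‖w - c‖ * Real.exp (C * ‖t‖)) ∧
      ∀ k, ∀ t ∈ ball (0 : ℂ) T, HasDerivAt (z (k + 1)) (F (z k t)) t := by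
  let S := {y : ℂ → E // y 0 = w ∧ DifferentiableOn ℂ y (ball 0 T) ∧
    ∀ t ∈ ball (0 : ℂ) T, ‖y t - c‖ ≤ ‖w - c‖ * Real.exp (C * ‖t‖)}
  have hstep : ∀ y : S, ∃ x : S, ∀ t ∈ ball (0 : ℂ) T, HasDerivAt x.1 (F (y.1 t)) t := by
    rintro ⟨y, -, hyd, hyb⟩
    have hmaps : Set.MapsTo y (ball 0 T) (ball c A) := fun t ht ↦ by
      rw [mem_ball, dist_eq_norm]
      exact (hyb t ht).trans_lt (hT t ht)
    obtain ⟨x, hx0, hx⟩ := (hF.comp hyd hmaps).isExactOn_ball.with_val_at 0 w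
    refine ⟨⟨x, hx0, fun t ht ↦ (hx t ht).differentiableAt.differentiableWithinAt,
      fun t ht ↦ ?_⟩, hx⟩
    refine norm_le_mul_exp_of_norm_hasDerivAt_le (f := fun s ↦ x s - c) (by rw [hx0])
      (fun s hs ↦ (hx s hs).sub_const c) (fun s hs ↦ ?_) ht
    calc ‖F (y s)‖ ≤ C * ‖y s - c‖ := hFC _ (hmaps hs)
      _ ≤ C * (‖w - c‖ * Real.exp (C * ‖s‖)) := by gcongr; exact hyb s hs
      _ = _ := by ring
  choose next hnext using hstep
  let start : S := ⟨fun _ ↦ w, rfl, differentiableOn_const w, fun t _ ↦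
    le_mul_of_one_le_right (norm_nonneg _) (Real.one_le_exp (by positivity))⟩
  refine ⟨fun k ↦ (next^[k] start).1, fun k ↦ (next^[k] start).2.1,
    fun k ↦ (next^[k] start).2.2.2, fun k ↦ ?_⟩
  simp only [Function.iterate_succ_apply']
  exact hnext _

/-- Long-time existence near a fixed point of a holomorphic vector field: if
`F(z₀) = 0` and `‖F(z)‖ ≤ C‖z − z₀‖` on `B(z₀, A)`, then for any initial condition
`w ≠ z₀` in the ball, a solution of `z' = F(z)` with `z(0) = w` exists on the disk
of radius `T = (1/C)·log(A/‖w − z₀‖)` and stays in the ball. -/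
theorem stmt_4 (n : ℕ) (z₀ : EuclideanSpace ℂ (Fin n)) (A C : ℝ) (hA : 0 < A) (hC : 0 < C)
    (F : EuclideanSpace ℂ (Fin n) → EuclideanSpace ℂ (Fin n))
    (hF : DifferentiableOn ℂ F (Metric.ball z₀ A))
    (hF0 : F z₀ = 0)
    (hFbound : ∀ ζ ∈ Metric.ball z₀ A, ‖F ζ‖ ≤ C * ‖ζ - z₀‖)
    (w : EuclideanSpace ℂ (Fin n)) (hw : w ∈ Metric.ball z₀ A) (hw0 : w ≠ z₀) :
    ∃ z : ℂ → EuclideanSpace ℂ (Fin n),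
      z 0 = w ∧
      (∀ t ∈ Metric.ball (0 : ℂ) ((1 / C) * Real.log (A / ‖w - z₀‖)),
        z t ∈ Metric.ball z₀ A) ∧
      (∀ t ∈ Metric.ball (0 : ℂ) ((1 / C) * Real.log (A / ‖w - z₀‖)),
        HasDerivAt z (F (z t)) t) := by
  set T := (1 / C) * Real.log (A / ‖w - z₀‖) with hTdef
  have hr : 0 < ‖w - z₀‖ := norm_pos_iff.2 (sub_ne_zero.2 hw0)
  have hexp : ∀ s < T, ‖w - z₀‖ * Real.exp (C * s) < A := by
    intro s hs
    have h : C * s < Real.log (A / ‖w - z₀‖) := by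
      rwa [hTdef, one_div, ← div_eq_inv_mul, lt_div_iff₀' hC] at hs
    rwa [Real.lt_log_iff_exp_lt (by positivity), lt_div_iff₀' hr] at h
  have hexp_mono : ∀ s s', s ≤ s' →
      ‖w - z₀‖ * Real.exp (C * s) ≤ ‖w - z₀‖ * Real.exp (C * s') := fun s s' h ↦ by gcongr
  obtain ⟨z, hz0, hzb, hzd⟩ := exists_picard_iterates (T := T) hC.le hF hFbound
    fun t ht ↦ hexp _ (mem_ball_zero_iff.1 ht)
  have hconv : ∀ t ∈ Metric.ball (0 : ℂ) T,
      Filter.Tendsto (fun k ↦ z k t) Filter.atTop (nhds (Filter.limUnder Filter.atTop fun k ↦ z k t)) ∧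
      HasDerivAt (fun s ↦ Filter.limUnder Filter.atTop fun k ↦ z k s)
        (F (Filter.limUnder Filter.atTop fun k ↦ z k t)) t := by
    intro t ht
    obtain ⟨T', htT', hT'⟩ := exists_between (mem_ball_zero_iff.1 ht)
    have hsub : Metric.ball (0 : ℂ) T' ⊆ Metric.ball 0 T := Metric.ball_subset_ball hT'.le
    obtain ⟨L, hL, hLip⟩ := exists_norm_sub_le_of_differentiableOn_ball (M := C * A)
      (hexp T' hT') hF fun x hx ↦ (hFbound x hx).trans <| by
        gcongr
        exact (mem_ball_iff_norm.1 hx).le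
    refine hasDerivAt_limUnder_picard_iterates hL hLip (fun k ↦ by rw [hz0, hz0])
      (fun k s hs ↦ ?_) (fun k s hs ↦ hzd k s (hsub hs)) (mem_ball_zero_iff.2 htT')
    rw [mem_closedBall_iff_norm]
    exact (hzb k s (hsub hs)).trans (hexp_mono _ _ (mem_ball_zero_iff.1 hs).le)
  refine ⟨fun t ↦ Filter.limUnder Filter.atTop fun k ↦ z k t, ?_, fun t ht ↦ ?_,
    fun t ht ↦ (hconv t ht).2⟩
  · simp only [hz0]
    exact tendsto_const_nhds.limUnder_eq
  · rw [mem_ball_iff_norm]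
    exact (le_of_tendsto ((hconv t ht).1.sub_const z₀).norm
      (Filter.Eventually.of_forall fun k ↦ hzb k t ht)).trans_lt
      (hexp _ (mem_ball_zero_iff.1 ht))
end

section
/- Let z₀ ∈ ℂⁿ, A > 0, C > 0, T > 0, and let F : ℂⁿ → ℂⁿ satisfy ‖F(ζ)‖ ≤ C‖ζ − z₀‖ for all ζ ∈ B(z₀, A). Suppose z : ℂ → ℂⁿ is differentiable on the open disk D_T = {t ∈ ℂ : |t| < T}, takes values in B(z₀, A), satisfies z(0) = w and z'(t) = F(z(t)) for all |t| < T. Then ‖z(t) − z₀‖ ≤ ‖w − z₀‖·e^{C|t|} for all t with |t| < T. -/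
/-- Gronwall-type estimate: if `‖F(ζ)‖ ≤ C‖ζ − z₀‖` on `B(z₀, A)` and `z` solves
`z' = F(z)` on the disk `D_T` with values in `B(z₀, A)` and `z(0) = w`, then
`‖z(t) − z₀‖ ≤ ‖w − z₀‖·e^{C|t|}` on `D_T`. -/
theorem stmt_5 (n : ℕ) (z₀ : EuclideanSpace ℂ (Fin n)) (A C T : ℝ)
    (hA : 0 < A) (hC : 0 < C) (hT : 0 < T)
    (F : EuclideanSpace ℂ (Fin n) → EuclideanSpace ℂ (Fin n))
    (hFbound : ∀ ζ ∈ Metric.ball z₀ A, ‖F ζ‖ ≤ C * ‖ζ - z₀‖)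
    (w : EuclideanSpace ℂ (Fin n)) (z : ℂ → EuclideanSpace ℂ (Fin n))
    (hz0 : z 0 = w)
    (hzball : ∀ t ∈ Metric.ball (0 : ℂ) T, z t ∈ Metric.ball z₀ A)
    (hz : ∀ t ∈ Metric.ball (0 : ℂ) T, HasDerivAt z (F (z t)) t) :
    ∀ t ∈ Metric.ball (0 : ℂ) T, ‖z t - z₀‖ ≤ ‖w - z₀‖ * Real.exp (C * ‖t‖) := by
  intro t ht
  have hmem : ∀ s ∈ Set.Icc (0 : ℝ) 1, (s : ℂ) * t ∈ Metric.ball (0 : ℂ) T := by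
    intro s hs
    rw [mem_ball_zero_iff] at ht ⊢
    rw [norm_mul, Complex.norm_real, Real.norm_of_nonneg hs.1]
    exact (mul_le_of_le_one_left (norm_nonneg t) hs.2).trans_lt ht
  have hderiv : ∀ s ∈ Set.Icc (0 : ℝ) 1,
      HasDerivAt (fun s : ℝ => z ((s : ℂ) * t) - z₀) (t • F (z ((s : ℂ) * t))) s := by
    intro s hs
    have hline : HasDerivAt (fun s : ℝ => (s : ℂ) * t) t s := by
      simpa using (Complex.ofRealCLM.hasDerivAt (x := s)).mul_const t
    exact ((hz _ (hmem s hs)).scomp s hline).sub_const z₀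
  have hbound := norm_le_gronwallBound_of_norm_deriv_right_le
    (δ := ‖w - z₀‖) (K := C * ‖t‖) (ε := 0)
    (fun s hs => (hderiv s hs).continuousAt.continuousWithinAt)
    (fun s hs => (hderiv s (Set.Ico_subset_Icc_self hs)).hasDerivWithinAt)
    (by simp [hz0])
    (fun s hs => by
      have hF := hFbound _ (hzball _ (hmem s (Set.Ico_subset_Icc_self hs)))
      rw [norm_smul, add_zero, mul_comm C, mul_assoc]
      gcongr)
    1 (Set.right_mem_Icc.2 zero_le_one)
  simpa [gronwallBound_ε0] using hbound
end

section
/- Fix constants m, η > 0 and B ∈ ℝ with B ≠ 0, and set B̃ = B/(mη). Then the map ℝ⁴ → ℂ² sending (x₁,x₂,p₁,p₂) to (z₁, z₂), where z₁ = x₁ + i·(sinh(B̃)/B)·p₁ − ((cosh(B̃) − 1)/B)·p₂ and z₂ = x₂ + i·(sinh(B̃)/B)·p₂ + ((cosh(B̃) − 1)/B)·p₁, is a bijection from ℝ⁴ onto ℂ². -/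
open Complex

/-- The complex coordinates `z₁, z₂` obtained from the magnetic flow at imaginary
time `i` give a bijection from `T*ℝ² ≅ ℝ⁴` onto `ℂ²`. -/
theorem stmt_8 (m η B : ℝ) (hm : 0 < m) (hη : 0 < η) (hB : B ≠ 0) :
    Function.Bijective (fun z : ℝ × ℝ × ℝ × ℝ =>
      (((z.1 : ℂ) + I * ((Real.sinh (B / (m * η)) / B : ℝ) : ℂ) * (z.2.2.1 : ℂ)
          - (((Real.cosh (B / (m * η)) - 1) / B : ℝ) : ℂ) * (z.2.2.2 : ℂ),
        (z.2.1 : ℂ) + I * ((Real.sinh (B / (m * η)) / B : ℝ) : ℂ) * (z.2.2.2 : ℂ)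
          + (((Real.cosh (B / (m * η)) - 1) / B : ℝ) : ℂ) * (z.2.2.1 : ℂ)) : ℂ × ℂ)) := by
  have hs : Real.sinh (B / (m * η)) / B ≠ 0 :=
    div_ne_zero (Real.sinh_ne_zero.mpr (div_ne_zero hB (mul_pos hm hη).ne')) hB
  generalize Real.sinh (B / (m * η)) / B = s at hs ⊢
  generalize (Real.cosh (B / (m * η)) - 1) / B = c
  constructor
  · rintro ⟨x₁, x₂, p₁, p₂⟩ ⟨y₁, y₂, q₁, q₂⟩ h
    simp only [Prod.mk.injEq, Complex.ext_iff] at h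
    simp [hs] at h
    obtain ⟨⟨h₁, rfl⟩, h₂, rfl⟩ := h
    simp_all
  · rintro ⟨w₁, w₂⟩
    refine ⟨(w₁.re + c * (w₂.im / s), w₂.re - c * (w₁.im / s), w₁.im / s, w₂.im / s), ?_⟩
    simp only [Prod.mk.injEq, Complex.ext_iff]
    simp [mul_div_cancel₀, hs]
end

section
/- Fix constants m, η > 0 and B ∈ ℝ with B ≠ 0, set B̃ = B/(mη), s = sinh(B̃), c = cosh(B̃). Consider the 4×4 complex matrix whose columns are u₁ = (i·s/B, (c−1)/B, c, −i·s), u₂ = (−(c−1)/B, i·s/B, i·s, c), v₁ = (−i·s/B, (c−1)/B, c, i·s), v₂ = (−(c−1)/B, −i·s/B, −i·s, c). Then its determinant equals −4·sinh²(B̃)/B²; in particular it is nonzero, so the four columns are linearly independent over ℂ. -/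
open Complex

/-- The determinant of the 4×4 matrix whose columns are the pushforwards
`(Φ_i)_* ∂_{p₁}, (Φ_i)_* ∂_{p₂}, (Φ_{−i})_* ∂_{p₁}, (Φ_{−i})_* ∂_{p₂}` equals
`−4·sinh²(B̃)/B²`; in particular it is nonzero and the columns are linearly
independent over `ℂ`. -/
theorem stmt_9 (m η B : ℝ) (hm : 0 < m) (hη : 0 < η) (hB : B ≠ 0)
    (s c : ℂ) (hs : s = (Real.sinh (B / (m * η)) : ℂ)) (hc : c = (Real.cosh (B / (m * η)) : ℂ))
    (u₁ u₂ v₁ v₂ : Fin 4 → ℂ)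
    (hu₁ : u₁ = ![I * s / B, (c - 1) / B, c, -(I * s)])
    (hu₂ : u₂ = ![-((c - 1) / B), I * s / B, I * s, c])
    (hv₁ : v₁ = ![-(I * s / B), (c - 1) / B, c, I * s])
    (hv₂ : v₂ = ![-((c - 1) / B), -(I * s / B), -(I * s), c])
    (M : Matrix (Fin 4) (Fin 4) ℂ)
    (hM : M = (Matrix.of ![u₁, u₂, v₁, v₂]).transpose) :
    M.det = -4 * (Real.sinh (B / (m * η)) : ℂ) ^ 2 / (B : ℂ) ^ 2 ∧ M.det ≠ 0 ∧
      LinearIndependent ℂ ![u₁, u₂, v₁, v₂] := by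
  have hB' : (B : ℂ) ≠ 0 := ofReal_ne_zero.mpr hB
  have hdet : M.det = -4 * (Real.sinh (B / (m * η)) : ℂ) ^ 2 / (B : ℂ) ^ 2 := by
    rw [hM, Matrix.det_transpose, ← hs, hu₁, hu₂, hv₁, hv₂]
    simp [Matrix.det_succ_row_zero, Fin.sum_univ_succ, Fin.succAbove]
    field_simp
    ring_nf
    simp only [I_sq]
    ring
  have hsinh : (Real.sinh (B / (m * η)) : ℂ) ≠ 0 :=
    ofReal_ne_zero.mpr <| Real.sinh_eq_zero.not.mpr <|
      div_ne_zero hB (mul_pos hm hη).ne'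
  have hne : M.det ≠ 0 := by
    rw [hdet]
    exact div_ne_zero (mul_ne_zero (by norm_num) (pow_ne_zero 2 hsinh)) (pow_ne_zero 2 hB')
  refine ⟨hdet, hne, ?_⟩
  rw [hM, Matrix.det_transpose] at hne
  exact Matrix.linearIndependent_rows_of_det_ne_zero hne
end

section
/- Fix constants m, η > 0 and B ∈ ℝ with B ≠ 0, and set B̃ = B/(mη). For x₁, x₂, p₁, p₂ ∈ ℝ let z₁ = x₁ + i·(sinh(B̃)/B)·p₁ − ((cosh(B̃) − 1)/B)·p₂ and z₂ = x₂ + i·(sinh(B̃)/B)·p₂ + ((cosh(B̃) − 1)/B)·p₁, and write x = Re z₁, y = Im z₁, u = Re z₂, v = Im z₂. Then: (i) p₁x₁ + p₂x₂ = (B/sinh(B̃))·(uv + xy); (ii) p₁x₂ − p₂x₁ = (B/sinh(B̃))·(uy − vx) − (B/sinh(B̃))·((cosh(B̃) − 1)/sinh(B̃))·(v² + y²); (iii) p₁² + p₂² = (B²/sinh²(B̃))·(v² + y²). -/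
open Complex

/-- Expressions for `p₁x₁ + p₂x₂`, `p₁x₂ − p₂x₁` and `p₁² + p₂²` in terms of the real
and imaginary parts of the holomorphic coordinates `z₁, z₂` of the magnetic complex
structure on `T*ℝ²` for the constant magnetic field `B·dx₁∧dx₂`. -/
theorem stmt_12 (m η B : ℝ) (hm : 0 < m) (hη : 0 < η) (hB : B ≠ 0)
    (x₁ x₂ p₁ p₂ : ℝ) (z₁ z₂ : ℂ)
    (hz₁ : z₁ = (x₁ : ℂ) + I * ((Real.sinh (B / (m * η)) / B : ℝ) : ℂ) * (p₁ : ℂ)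
      - (((Real.cosh (B / (m * η)) - 1) / B : ℝ) : ℂ) * (p₂ : ℂ))
    (hz₂ : z₂ = (x₂ : ℂ) + I * ((Real.sinh (B / (m * η)) / B : ℝ) : ℂ) * (p₂ : ℂ)
      + (((Real.cosh (B / (m * η)) - 1) / B : ℝ) : ℂ) * (p₁ : ℂ))
    (x y u v : ℝ) (hx : x = z₁.re) (hy : y = z₁.im) (hu : u = z₂.re) (hv : v = z₂.im) :
    p₁ * x₁ + p₂ * x₂ = B / Real.sinh (B / (m * η)) * (u * v + x * y) ∧
      p₁ * x₂ - p₂ * x₁ = B / Real.sinh (B / (m * η)) * (u * y - v * x)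
        - B / Real.sinh (B / (m * η))
          * ((Real.cosh (B / (m * η)) - 1) / Real.sinh (B / (m * η)))
          * (v ^ 2 + y ^ 2) ∧
      p₁ ^ 2 + p₂ ^ 2 = B ^ 2 / Real.sinh (B / (m * η)) ^ 2 * (v ^ 2 + y ^ 2) := by
  have hS : Real.sinh (B / (m * η)) ≠ 0 :=
    Real.sinh_ne_zero.mpr (div_ne_zero hB (mul_pos hm hη).ne')
  generalize Real.sinh (B / (m * η)) = S at *
  generalize Real.cosh (B / (m * η)) = C at *
  have hx' : x = x₁ - (C - 1) / B * p₂ := by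
    rw [hx, hz₁]
    simp only [sub_re, add_re, mul_re, mul_im, I_re, I_im, ofReal_re, ofReal_im]
    ring
  have hy' : y = S / B * p₁ := by
    rw [hy, hz₁]
    simp only [sub_im, add_im, mul_re, mul_im, I_re, I_im, ofReal_re, ofReal_im]
    ring
  have hu' : u = x₂ + (C - 1) / B * p₁ := by
    rw [hu, hz₂]
    simp only [add_re, mul_re, mul_im, I_re, I_im, ofReal_re, ofReal_im]
    ring
  have hv' : v = S / B * p₂ := by
    rw [hv, hz₂]
    simp only [add_im, mul_re, mul_im, I_re, I_im, ofReal_re, ofReal_im]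
    ring
  rw [hx', hy', hu', hv']
  refine ⟨?_, ?_, ?_⟩ <;> field_simp <;> ring
end

section
/- Fix constants m, η > 0 and B ∈ ℝ with B ≠ 0, and set B̃ = B/(mη). For x₁, x₂, p₁, p₂ ∈ ℝ let z₁ = x₁ + i·(sinh(B̃)/B)·p₁ − ((cosh(B̃) − 1)/B)·p₂ and z₂ = x₂ + i·(sinh(B̃)/B)·p₂ + ((cosh(B̃) − 1)/B)·p₁, write x = Re z₁, y = Im z₁, u = Re z₂, v = Im z₂, and set F = −i·(cosh(B̃) − 1)·(p₁x₁ + p₂x₂) − sinh(B̃)·(p₁x₂ − p₂x₁) + (sinh(B̃)/B)·(p₁² + p₂²). Then Re F = −B·(uy − vx) + B·coth(B̃)·(v² + y²). -/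
open Complex

/-- The real part of `F = 2i·f_{−i}` is the Kähler potential
`κ₂ = −B(uy − vx) + B·coth(B̃)(v² + y²)` appearing in the work of
Krötz–Thangavelu–Xu. -/
theorem stmt_14 (m η B : ℝ) (hm : 0 < m) (hη : 0 < η) (hB : B ≠ 0)
    (x₁ x₂ p₁ p₂ : ℝ) (z₁ z₂ : ℂ)
    (hz₁ : z₁ = (x₁ : ℂ) + I * ((Real.sinh (B / (m * η)) / B : ℝ) : ℂ) * (p₁ : ℂ)
      - (((Real.cosh (B / (m * η)) - 1) / B : ℝ) : ℂ) * (p₂ : ℂ))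
    (hz₂ : z₂ = (x₂ : ℂ) + I * ((Real.sinh (B / (m * η)) / B : ℝ) : ℂ) * (p₂ : ℂ)
      + (((Real.cosh (B / (m * η)) - 1) / B : ℝ) : ℂ) * (p₁ : ℂ))
    (x y u v : ℝ) (hx : x = z₁.re) (hy : y = z₁.im) (hu : u = z₂.re) (hv : v = z₂.im)
    (F : ℂ)
    (hF : F = -I * ((Real.cosh (B / (m * η)) - 1 : ℝ) : ℂ) * ((p₁ * x₁ + p₂ * x₂ : ℝ) : ℂ)
      - ((Real.sinh (B / (m * η)) : ℝ) : ℂ) * ((p₁ * x₂ - p₂ * x₁ : ℝ) : ℂ)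
      + ((Real.sinh (B / (m * η)) / B : ℝ) : ℂ) * ((p₁ ^ 2 + p₂ ^ 2 : ℝ) : ℂ)) :
    F.re = -B * (u * y - v * x)
      + B * (Real.cosh (B / (m * η)) / Real.sinh (B / (m * η))) * (v ^ 2 + y ^ 2) := by
  have hs : Real.sinh (B / (m * η)) ≠ 0 :=
    Real.sinh_ne_zero.mpr (div_ne_zero hB (mul_pos hm hη).ne')
  generalize Real.sinh (B / (m * η)) = s at *
  generalize Real.cosh (B / (m * η)) = c at *
  have hx' : x = x₁ - (c - 1) / B * p₂ := by
    rw [hx, hz₁]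
    simp only [add_re, sub_re, mul_re, mul_im, ofReal_re, ofReal_im, I_re, I_im]
    ring
  have hy' : y = s / B * p₁ := by
    rw [hy, hz₁]
    simp only [add_im, sub_im, mul_re, mul_im, ofReal_re, ofReal_im, I_re, I_im]
    ring
  have hu' : u = x₂ + (c - 1) / B * p₁ := by
    rw [hu, hz₂]
    simp only [add_re, mul_re, mul_im, ofReal_re, ofReal_im, I_re, I_im]
    ring
  have hv' : v = s / B * p₂ := by
    rw [hv, hz₂]
    simp only [add_im, mul_re, mul_im, ofReal_re, ofReal_im, I_re, I_im]
    ring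
  have hF' : F.re = -s * (p₁ * x₂ - p₂ * x₁) + s / B * (p₁ ^ 2 + p₂ ^ 2) := by
    rw [hF]
    simp only [add_re, sub_re, neg_re, neg_im, mul_re, mul_im, ofReal_re, ofReal_im, I_re, I_im]
    ring
  rw [hF', hx', hy', hu', hv']
  field_simp
  ring
end
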